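/- In the setting of the previous identity (𝒴 = ℝ^d × 𝕋^d, ρ⁰(p,r) = ρ^OU(p)ρ₀(r), ℬf = p·∇_r f + b(r)·∇_p f, h(r) = b(r) - ∇_r log ρ₀(r) bounded with K = sup_r |h(r)|), for every η > 0 and every f with f, ∇_p f ∈ L²(𝒴; ρ⁰), one has ⟨f, ℬf⟩_{L²(𝒴;ρ⁰)} ≥ -K ( η ‖f‖²_{L²(𝒴;ρ⁰)} + (1/(4η)) ‖∇_p f‖²_{L²(𝒴;ρ⁰)} ). -/

import Mathlib

open MeasureTheory Real Filter

noncomputable section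

/-- The standard Gaussian (Ornstein–Uhlenbeck invariant) density on ℝ^d. -/
def gaussDensity (d : ℕ) (p : Fin d → ℝ) : ℝ :=
  (2 * π) ^ (-(d : ℝ) / 2) * Real.exp (-(∑ i, p i ^ 2) / 2)

/-- Partial derivative in the i-th p-coordinate. -/
def pd (d : ℕ) (i : Fin d) (f : (Fin d → ℝ) × (Fin d → ℝ) → ℝ) :
    (Fin d → ℝ) × (Fin d → ℝ) → ℝ :=
  fun x => fderiv ℝ (fun p => f (p, x.2)) x.1 (Pi.single i 1)

/-- Partial derivative in the i-th r-coordinate. -/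
def rd (d : ℕ) (i : Fin d) (f : (Fin d → ℝ) × (Fin d → ℝ) → ℝ) :
    (Fin d → ℝ) × (Fin d → ℝ) → ℝ :=
  fun x => fderiv ℝ (fun r => f (x.1, r)) x.2 (Pi.single i 1)

/-- Reference measure on 𝒴 = ℝ^d × 𝕋^d : Lebesgue on ℝ^d times Lebesgue on a
fundamental domain (unit cube) of the torus. -/
def refMeas (d : ℕ) : Measure ((Fin d → ℝ) × (Fin d → ℝ)) :=
  (volume : Measure (Fin d → ℝ)).prod
    ((volume : Measure (Fin d → ℝ)).restrict (Set.Icc 0 1))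

/-- Product reference density ρ⁰(p,r) = ρ^OU(p) ρ₀(r). -/
def rho0 (d : ℕ) (ρ₀ : (Fin d → ℝ) → ℝ) (x : (Fin d → ℝ) × (Fin d → ℝ)) : ℝ :=
  gaussDensity d x.1 * ρ₀ x.2

/-- Integral against the weight ρ⁰ on 𝒴. -/
def wInt (d : ℕ) (ρ₀ : (Fin d → ℝ) → ℝ) (F : (Fin d → ℝ) × (Fin d → ℝ) → ℝ) : ℝ :=
  ∫ x, F x * rho0 d ρ₀ x ∂refMeas d

/-- ℤ^d-periodicity in the r-variable (i.e. f is a function on ℝ^d × 𝕋^d). -/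
def PeriodicR (d : ℕ) (f : (Fin d → ℝ) × (Fin d → ℝ) → ℝ) : Prop :=
  ∀ x : (Fin d → ℝ) × (Fin d → ℝ), ∀ i : Fin d, f (x.1, x.2 + Pi.single i 1) = f x

/-- The transport operator ℬ f = p·∇_r f + b(r)·∇_p f. -/
def Bop (d : ℕ) (b : (Fin d → ℝ) → Fin d → ℝ)
    (f : (Fin d → ℝ) × (Fin d → ℝ) → ℝ) : (Fin d → ℝ) × (Fin d → ℝ) → ℝ :=
  fun x => (∑ i, x.1 i * rd d i f x) + ∑ i, b x.2 i * pd d i f x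

/-- The kinetic (hypoelliptic) operator
ℒ^m f = (1/m)(-p·∇_p f + Δ_p f) + (1/√m) ℬ f. -/
def Lkin (d : ℕ) (m : ℝ) (b : (Fin d → ℝ) → Fin d → ℝ)
    (f : (Fin d → ℝ) × (Fin d → ℝ) → ℝ) : (Fin d → ℝ) × (Fin d → ℝ) → ℝ :=
  fun x => (1 / m) * ((- ∑ i, x.1 i * pd d i f x) + ∑ i, pd d i (pd d i f) x)
    + (1 / Real.sqrt m) * Bop d b f x

/-- The function h(r) = b(r) - ∇_r log ρ₀(r), componentwise. -/
def hfun (d : ℕ) (b : (Fin d → ℝ) → Fin d → ℝ) (ρ₀ : (Fin d → ℝ) → ℝ)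
    (r : Fin d → ℝ) (i : Fin d) : ℝ :=
  b r i - fderiv ℝ ρ₀ r (Pi.single i 1) / ρ₀ r

theorem aux_hasDerivAt_p {d : ℕ} (i : Fin d) {F : (Fin d → ℝ) × (Fin d → ℝ) → ℝ}
    (hF : Differentiable ℝ F) (x : (Fin d → ℝ) × (Fin d → ℝ)) :
    HasDerivAt (fun t : ℝ => F (x.1 + t • Pi.single i 1, x.2)) (pd d i F x) 0 := by
  have h1 : HasFDerivAt (fun p => F (p, x.2)) (fderiv ℝ (fun p => F (p, x.2)) x.1)
      (x.1 + (0:ℝ) • Pi.single i 1) := by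
    rw [zero_smul, add_zero]
    apply DifferentiableAt.hasFDerivAt
    fun_prop
  have h2 : HasDerivAt (fun t : ℝ => x.1 + t • (Pi.single i 1 : Fin d → ℝ)) (Pi.single i 1) 0 := by
    simpa using ((hasDerivAt_id (0:ℝ)).smul_const (Pi.single i 1 : Fin d → ℝ)).const_add x.1
  exact h1.comp_hasDerivAt (0:ℝ) h2

theorem aux_hasDerivAt_r {d : ℕ} (i : Fin d) {F : (Fin d → ℝ) × (Fin d → ℝ) → ℝ}
    (hF : Differentiable ℝ F) (x : (Fin d → ℝ) × (Fin d → ℝ)) :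
    HasDerivAt (fun t : ℝ => F (x.1, x.2 + t • Pi.single i 1)) (rd d i F x) 0 := by
  have h1 : HasFDerivAt (fun p => F (x.1, p)) (fderiv ℝ (fun p => F (x.1, p)) x.2)
      (x.2 + (0:ℝ) • Pi.single i 1) := by
    rw [zero_smul, add_zero]
    apply DifferentiableAt.hasFDerivAt
    fun_prop
  have h2 : HasDerivAt (fun t : ℝ => x.2 + t • (Pi.single i 1 : Fin d → ℝ)) (Pi.single i 1) 0 := by
    simpa using ((hasDerivAt_id (0:ℝ)).smul_const (Pi.single i 1 : Fin d → ℝ)).const_add x.2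
  exact h1.comp_hasDerivAt (0:ℝ) h2

theorem aux_pd_eq {d : ℕ} (i : Fin d) {F : (Fin d → ℝ) × (Fin d → ℝ) → ℝ}
    (hF : Differentiable ℝ F) (x : (Fin d → ℝ) × (Fin d → ℝ)) :
    pd d i F x = fderiv ℝ F x (Pi.single i 1, 0) := by
  have h := (hF x).hasFDerivAt.comp x.1
    (f := fun p : Fin d → ℝ => (p, x.2)) (hasFDerivAt_prodMk_left x.1 x.2)
  have h' : fderiv ℝ (fun p => F (p, x.2)) x.1 = _ := h.fderiv
  simp [pd, h']

theorem aux_rd_eq {d : ℕ} (i : Fin d) {F : (Fin d → ℝ) × (Fin d → ℝ) → ℝ}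
    (hF : Differentiable ℝ F) (x : (Fin d → ℝ) × (Fin d → ℝ)) :
    rd d i F x = fderiv ℝ F x (0, Pi.single i 1) := by
  have h := (hF x).hasFDerivAt.comp x.2
    (f := fun p : Fin d → ℝ => (x.1, p)) (hasFDerivAt_prodMk_right x.1 x.2)
  have h' : fderiv ℝ (fun p => F (x.1, p)) x.2 = _ := h.fderiv
  simp [rd, h']

theorem aux_pd_cont {d : ℕ} (i : Fin d) {F : (Fin d → ℝ) × (Fin d → ℝ) → ℝ}
    (hF : ContDiff ℝ 1 F) : Continuous (pd d i F) := by
  rw [funext (aux_pd_eq i (hF.differentiable one_ne_zero))]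
  exact (hF.continuous_fderiv one_ne_zero).clm_apply continuous_const

theorem aux_rd_cont {d : ℕ} (i : Fin d) {F : (Fin d → ℝ) × (Fin d → ℝ) → ℝ}
    (hF : ContDiff ℝ 1 F) : Continuous (rd d i F) := by
  rw [funext (aux_rd_eq i (hF.differentiable one_ne_zero))]
  exact (hF.continuous_fderiv one_ne_zero).clm_apply continuous_const

theorem aux_integrable {d : ℕ} {F : (Fin d → ℝ) × (Fin d → ℝ) → ℝ} (hF : Continuous F)
    (R : ℝ) (hR : ∀ x, R < ‖x.1‖ → F x = 0) : Integrable F (refMeas d) := by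
  have e : refMeas d = ((volume : Measure (Fin d → ℝ)).prod
      (volume : Measure (Fin d → ℝ))).restrict (Set.univ ×ˢ Set.Icc 0 1) := by
    rw [← Measure.prod_restrict, Measure.restrict_univ]; rfl
  rw [e]
  have hc : IsCompact (Metric.closedBall (0 : Fin d → ℝ) R ×ˢ Set.Icc (0 : Fin d → ℝ) 1) :=
    (isCompact_closedBall _ _).prod isCompact_Icc
  refine IntegrableOn.of_forall_sdiff_eq_zero (hF.continuousOn.integrableOn_compact hc)
    (MeasurableSet.univ.prod measurableSet_Icc) ?_
  rintro x ⟨hx1, hx2⟩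
  apply hR
  by_contra hh
  apply hx2
  exact ⟨by simpa using hh, hx1.2⟩

theorem aux_int_pd {d : ℕ} (i : Fin d) {F : (Fin d → ℝ) × (Fin d → ℝ) → ℝ} (hF : ContDiff ℝ 1 F)
    (R : ℝ) (hR : ∀ x, R < ‖x.1‖ → F x = 0) :
    Integrable (pd d i F) (refMeas d) ∧ ∫ x, pd d i F x ∂refMeas d = 0 := by
  have hz : ∀ x, R < ‖x.1‖ → pd d i F x = 0 := by
    intro x hx
    have : (fun p => F (p, x.2)) =ᶠ[nhds x.1] fun _ => 0 := by
      filter_upwards [(isOpen_lt continuous_const continuous_norm).mem_nhds hx] with p hp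
      exact hR _ hp
    simp [pd, this.fderiv_eq]
  have hI := aux_integrable (aux_pd_cont i hF) R hz
  refine ⟨hI, ?_⟩
  unfold refMeas at hI ⊢
  rw [integral_prod_symm _ hI]
  apply integral_eq_zero_of_ae
  refine Eventually.of_forall fun r => ?_
  have hs : ∀ G : (Fin d → ℝ) → ℝ, (∀ p, R < ‖p‖ → G p = 0) → HasCompactSupport G := by
    intro G hG
    refine HasCompactSupport.of_support_subset_isCompact (isCompact_closedBall (0 : Fin d → ℝ) R) ?_
    intro p hp
    by_contra hh
    exact hp (hG p (by simpa using hh))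
  have hFc : ContDiff ℝ 1 (fun p => F (p, r)) := by fun_prop
  have := integral_mul_fderiv_eq_neg_fderiv_mul_of_integrable (𝕜 := ℝ)
    (μ := (volume : Measure (Fin d → ℝ))) (f := fun _ => (1:ℝ))
    (g := fun p => F (p, r)) (v := Pi.single i 1) (by simp)
    (by
      simp only [one_mul]
      refine Continuous.integrable_of_hasCompactSupport ?_ (hs _ fun p hp => hz (p, r) hp)
      exact (aux_pd_cont i hF).comp (by fun_prop : Continuous fun p : Fin d → ℝ => (p, r)))
    (by
      simp only [one_mul]
      exact Continuous.integrable_of_hasCompactSupport (by fun_prop) (hs _ fun p hp => hR (p, r) hp))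
    (by intros; fun_prop) (by intro p _; exact hFc.differentiable one_ne_zero p)
  simpa [pd] using this

theorem aux_int_periodic {d : ℕ} (i : Fin d) {g : (Fin d → ℝ) → ℝ} (hg : ContDiff ℝ 1 g)
    (hper : ∀ r, g (r + Pi.single i 1) = g r) :
    ∫ r in Set.Icc (0 : Fin d → ℝ) 1, fderiv ℝ g r (Pi.single i 1) = 0 := by
  obtain _ | n := d
  · exact i.elim0
  have hcd : Continuous fun r => fderiv ℝ g r (Pi.single i 1) :=
    (hg.continuous_fderiv one_ne_zero).clm_apply continuous_const
  have hsum : ∀ r, ∑ j, (if j = i then fderiv ℝ g r else 0) (Pi.single j 1)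
      = fderiv ℝ g r (Pi.single i 1) := by
    intro r
    rw [Finset.sum_eq_single i]
    · simp
    · intro j _ hj; simp [hj]
    · simp
  have := integral_divergence_of_hasFDerivAt_off_countable' (0 : Fin (n+1) → ℝ) 1 zero_le_one
    (fun j r => if j = i then g r else 0) (fun j r => if j = i then fderiv ℝ g r else 0) ∅
    Set.countable_empty
    (by
      intro j
      by_cases h : j = i
      · simp only [h, if_true]; exact hg.continuous.continuousOn
      · simp only [h, if_false]; exact continuousOn_const)
    (by
      intro x _ j
      by_cases h : j = i
      · simp only [h, if_true]; exact (hg.differentiable one_ne_zero x).hasFDerivAt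
      · simp only [h, if_false]; exact hasFDerivAt_const _ _)
    (by
      simp only [hsum]
      exact hcd.continuousOn.integrableOn_compact isCompact_Icc)
  simp only [hsum] at this
  rw [this, Finset.sum_eq_zero]
  intro j _
  by_cases h : j = i
  · subst h
    simp only [if_true]
    rw [sub_eq_zero]
    congr 1
    funext r
    refine Eq.trans ?_ (hper _)
    congr 1
    funext k
    rcases Fin.eq_self_or_eq_succAbove j k with rfl | ⟨l, rfl⟩
    · simp
    · simp
  · simp [h]

theorem aux_int_rd {d : ℕ} (i : Fin d) {F : (Fin d → ℝ) × (Fin d → ℝ) → ℝ} (hF : ContDiff ℝ 1 F)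
    (hper : ∀ x, F (x.1, x.2 + Pi.single i 1) = F x)
    (R : ℝ) (hR : ∀ x, R < ‖x.1‖ → F x = 0) :
    Integrable (rd d i F) (refMeas d) ∧ ∫ x, rd d i F x ∂refMeas d = 0 := by
  have hz : ∀ x, R < ‖x.1‖ → rd d i F x = 0 := by
    intro x hx
    have : (fun r => F (x.1, r)) = fun _ => 0 := by
      funext r
      exact hR _ hx
    simp [rd, this]
  have hI := aux_integrable (aux_rd_cont i hF) R hz
  refine ⟨hI, ?_⟩
  unfold refMeas at hI ⊢
  rw [integral_prod _ hI]
  apply integral_eq_zero_of_ae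
  refine Eventually.of_forall fun p => ?_
  exact aux_int_periodic i (g := fun r => F (p, r)) (by fun_prop) (fun r => hper (p, r))

theorem aux_gauss_contDiff (d : ℕ) : ContDiff ℝ 1 (gaussDensity d) := by
  unfold gaussDensity
  fun_prop

theorem aux_gauss_pos (d : ℕ) (p : Fin d → ℝ) : 0 < gaussDensity d p := by
  unfold gaussDensity
  positivity

theorem aux_gauss_deriv {d : ℕ} (i : Fin d) (p : Fin d → ℝ) :
    HasDerivAt (fun t : ℝ => gaussDensity d (p + t • Pi.single i 1))
      (-(p i) * gaussDensity d p) 0 := by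
  have h1 : ∀ j ∈ (Finset.univ : Finset (Fin d)),
      HasDerivAt (fun t : ℝ => (p + t • (Pi.single i 1 : Fin d → ℝ)) j ^ 2)
      (2 * p j * (Pi.single i 1 : Fin d → ℝ) j) 0 := by
    intro j _
    have := (((hasDerivAt_id (0:ℝ)).mul_const ((Pi.single i 1 : Fin d → ℝ) j)).const_add (p j)).fun_pow 2
    simpa using this
  have h2 := HasDerivAt.fun_sum h1
  have h3 := ((h2.neg.div_const 2).exp).const_mul ((2 * π) ^ (-(d : ℝ) / 2))
  have hs : ∑ j, 2 * p j * (Pi.single i 1 : Fin d → ℝ) j = 2 * p i := by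
    rw [Finset.sum_eq_single i]
    · simp
    · intro j _ hj; simp [hj]
    · simp
  unfold gaussDensity
  refine h3.congr_deriv ?_
  rw [hs]
  simp
  ring

theorem aux_identity {d : ℕ} {ρ₀ : (Fin d → ℝ) → ℝ} (hρ : ContDiff ℝ 2 ρ₀)
    (hρper : ∀ r : Fin d → ℝ, ∀ i : Fin d, ρ₀ (r + Pi.single i 1) = ρ₀ r)
    {f : (Fin d → ℝ) × (Fin d → ℝ) → ℝ} (hf : ContDiff ℝ 1 f) (hfper : PeriodicR d f)
    {χ : (Fin d → ℝ) → ℝ} (hχ : ContDiff ℝ 1 χ) (R : ℝ) (hR : ∀ p, R < ‖p‖ → χ p = 0) :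
    ∫ x, (∑ i, (2 * χ x.1 * f x * gaussDensity d x.1 *
        (x.1 i * rd d i f x * ρ₀ x.2 + fderiv ℝ ρ₀ x.2 (Pi.single i 1) * pd d i f x)
      + fderiv ℝ ρ₀ x.2 (Pi.single i 1) * fderiv ℝ χ x.1 (Pi.single i 1)
          * f x ^ 2 * gaussDensity d x.1)) ∂refMeas d = 0 := by
  have hg := aux_gauss_contDiff d
  have hρ1 : ContDiff ℝ 1 ρ₀ := hρ.of_le (by norm_num)
  have hD : ∀ i : Fin d, ContDiff ℝ 1 fun r => fderiv ℝ ρ₀ r (Pi.single i 1) := by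
    intro i
    exact (hρ.fderiv_right (m := 1) (by norm_num)).clm_apply contDiff_const
  let A : Fin d → (Fin d → ℝ) × (Fin d → ℝ) → ℝ := fun i x =>
    (x.1 i * χ x.1 * gaussDensity d x.1) * (f x ^ 2 * ρ₀ x.2)
  let B : Fin d → (Fin d → ℝ) × (Fin d → ℝ) → ℝ := fun i x =>
    fderiv ℝ ρ₀ x.2 (Pi.single i 1) * (χ x.1 * f x ^ 2 * gaussDensity d x.1)
  have hA : ∀ i, ContDiff ℝ 1 (A i) := by
    intro i
    have h1 : ContDiff ℝ 1 fun x : (Fin d → ℝ) × (Fin d → ℝ) => x.1 i := by fun_prop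
    exact ((h1.mul (hχ.comp contDiff_fst)).mul (hg.comp contDiff_fst)).mul
      ((hf.pow 2).mul (hρ1.comp contDiff_snd))
  have hB : ∀ i, ContDiff ℝ 1 (B i) := by
    intro i
    exact ((hD i).comp contDiff_snd).mul (((hχ.comp contDiff_fst).mul (hf.pow 2)).mul
      (hg.comp contDiff_fst))
  have kA := fun i => aux_int_rd i (hA i)
    (by
      intro x
      have := hfper x i
      simp only [A, this, hρper]) R (by intro x hx; simp [A, hR _ hx])
  have kB := fun i => aux_int_pd i (hB i) R (by intro x hx; simp [B, hR _ hx])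
  have dA : ∀ i x, rd d i (A i) x = (x.1 i * χ x.1 * gaussDensity d x.1) *
      (2 * f x * rd d i f x * ρ₀ x.2 + f x ^ 2 * fderiv ℝ ρ₀ x.2 (Pi.single i 1)) := by
    intro i x
    have e1 := aux_hasDerivAt_r i ((hA i).differentiable one_ne_zero) x
    have e2 := aux_hasDerivAt_r i (hf.differentiable one_ne_zero) x
    have e3 := aux_hasDerivAt_r i (F := fun x => ρ₀ x.2)
      ((hρ1.comp contDiff_snd).differentiable one_ne_zero) x
    have e4 := (((e2.fun_pow 2).fun_mul e3)).const_mul (x.1 i * χ x.1 * gaussDensity d x.1)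
    have := e1.unique e4
    rw [this]
    simp [rd]
  have dB : ∀ i x, pd d i (B i) x = fderiv ℝ ρ₀ x.2 (Pi.single i 1) *
      ((fderiv ℝ χ x.1 (Pi.single i 1) * f x ^ 2 + χ x.1 * (2 * f x * pd d i f x))
        * gaussDensity d x.1 + χ x.1 * f x ^ 2 * (-(x.1 i) * gaussDensity d x.1)) := by
    intro i x
    have e1 := aux_hasDerivAt_p i ((hB i).differentiable one_ne_zero) x
    have e2 := aux_hasDerivAt_p i (hf.differentiable one_ne_zero) x
    have e3 := aux_hasDerivAt_p i (F := fun x => χ x.1)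
      ((hχ.comp contDiff_fst).differentiable one_ne_zero) x
    have e4 := ((e3.fun_mul (e2.fun_pow 2)).fun_mul (aux_gauss_deriv i x.1)).const_mul
      (fderiv ℝ ρ₀ x.2 (Pi.single i 1))
    have := e1.unique e4
    rw [this]
    simp [pd]
  rw [← Finset.sum_eq_zero (s := Finset.univ) (fun i _ => show
    ∫ x, (rd d i (A i) x + pd d i (B i) x) ∂refMeas d = 0 by
      rw [integral_add (kA i).1 (kB i).1, (kA i).2, (kB i).2, add_zero]),
    ← integral_finsetSum (f := fun i x => rd d i (A i) x + pd d i (B i) x) _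
      (fun i _ => (kA i).1.add (kB i).1)]
  congr 1
  funext x
  refine Finset.sum_congr rfl fun i _ => ?_
  rw [dA, dB]
  ring

/-- The antisymmetric (Hamiltonian) part of the transport operator has zero quadratic form. -/
theorem aux_zero {d : ℕ} {ρ₀ : (Fin d → ℝ) → ℝ} (hρ : ContDiff ℝ 2 ρ₀) (hρpos : ∀ r, 0 < ρ₀ r)
    (hρper : ∀ r : Fin d → ℝ, ∀ i : Fin d, ρ₀ (r + Pi.single i 1) = ρ₀ r)
    {f : (Fin d → ℝ) × (Fin d → ℝ) → ℝ} (hf : ContDiff ℝ 1 f) (hfper : PeriodicR d f)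
    (hf2 : Integrable (fun x => f x ^ 2 * rho0 d ρ₀ x) (refMeas d))
    (hG : Integrable (fun x => ∑ i, (2 * f x * gaussDensity d x.1 *
        (x.1 i * rd d i f x * ρ₀ x.2 + fderiv ℝ ρ₀ x.2 (Pi.single i 1) * pd d i f x)))
      (refMeas d)) :
    ∫ x, (∑ i, (2 * f x * gaussDensity d x.1 *
        (x.1 i * rd d i f x * ρ₀ x.2 + fderiv ℝ ρ₀ x.2 (Pi.single i 1) * pd d i f x)))
      ∂refMeas d = 0 := by
  let φ : ContDiffBump (0 : Fin d → ℝ) := ⟨1, 2, one_pos, one_lt_two⟩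
  have hφ : ContDiff ℝ 1 φ := φ.contDiff
  let c : ℕ → ℝ := fun n => ((n : ℝ) + 1)⁻¹
  have hc0 : ∀ n, 0 < c n := fun n => by positivity
  have hc1 : ∀ n, c n ≤ 1 := fun n => inv_le_one_of_one_le₀ (by linarith [n.cast_nonneg (α := ℝ)])
  have hct : Tendsto c atTop (nhds 0) := by
    simpa [c] using tendsto_one_div_add_atTop_nhds_zero_nat (𝕜 := ℝ)
  let χ : ℕ → (Fin d → ℝ) → ℝ := fun n p => φ (c n • p)
  have hχ : ∀ n, ContDiff ℝ 1 (χ n) := fun n => hφ.comp (contDiff_const_smul (c n))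
  have hχR : ∀ n p, 2 * (c n)⁻¹ < ‖p‖ → χ n p = 0 := by
    intro n p hp
    apply φ.zero_of_le_dist
    have : (2:ℝ) ≤ c n * ‖p‖ := by
      have := mul_lt_mul_of_pos_left hp (hc0 n)
      rw [mul_left_comm, mul_inv_cancel₀ (hc0 n).ne'] at this
      linarith
    simpa [norm_smul, abs_of_pos (hc0 n)] using this
  have hχd : ∀ n p v, fderiv ℝ (χ n) p v = c n * fderiv ℝ φ (c n • p) v := by
    intro n p v
    simp only [χ]
    rw [fderiv_comp_smul]
    simp
  have hχ1 : ∀ p, ∀ᶠ n in atTop, χ n p = 1 := by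
    intro p
    have h1 : Tendsto (fun n => c n • p) atTop (nhds 0) := by
      simpa using hct.smul_const p
    exact h1.eventually φ.eventuallyEq_one
  obtain ⟨C, hC⟩ := (φ.hasCompactSupport.fderiv (𝕜 := ℝ)).exists_bound_of_continuous
    (hφ.continuous_fderiv one_ne_zero)
  have hC0 : 0 ≤ C := (norm_nonneg _).trans (hC 0)
  have hDc : ∀ i : Fin d, Continuous fun r => fderiv ℝ ρ₀ r (Pi.single i 1) := fun i =>
    (hρ.continuous_fderiv two_ne_zero).clm_apply continuous_const
  have hSc : Continuous fun r => ∑ i : Fin d, |fderiv ℝ ρ₀ r (Pi.single i 1)| / ρ₀ r :=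
    continuous_finsetSum _ fun i _ => (hDc i).abs.div hρ.continuous fun r => (hρpos r).ne'
  obtain ⟨M, hM⟩ := (isCompact_Icc (a := (0 : Fin d → ℝ)) (b := 1)).exists_bound_of_continuousOn
    hSc.continuousOn
  have hgc := (aux_gauss_contDiff d).continuous
  have hfc := hf.continuous
  have hρc := hρ.continuous
  have hpc := fun i => aux_pd_cont i hf
  have hrc := fun i => aux_rd_cont i hf
  have hae : ∀ᵐ x ∂refMeas d, x.2 ∈ Set.Icc (0 : Fin d → ℝ) 1 := by
    have : refMeas d = ((volume : Measure (Fin d → ℝ)).prod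
        (volume : Measure (Fin d → ℝ))).restrict (Set.univ ×ˢ Set.Icc 0 1) := by
      rw [← Measure.prod_restrict, Measure.restrict_univ]; rfl
    rw [this]
    filter_upwards [ae_restrict_mem (MeasurableSet.univ.prod measurableSet_Icc)] with x hx
    exact hx.2
  have hlim := tendsto_integral_of_dominated_convergence (μ := refMeas d)
    (F := fun n x => (∑ i, (2 * χ n x.1 * f x * gaussDensity d x.1 *
        (x.1 i * rd d i f x * ρ₀ x.2 + fderiv ℝ ρ₀ x.2 (Pi.single i 1) * pd d i f x)
      + fderiv ℝ ρ₀ x.2 (Pi.single i 1) * fderiv ℝ (χ n) x.1 (Pi.single i 1)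
          * f x ^ 2 * gaussDensity d x.1)))
    (f := fun x => ∑ i, (2 * f x * gaussDensity d x.1 *
        (x.1 i * rd d i f x * ρ₀ x.2 + fderiv ℝ ρ₀ x.2 (Pi.single i 1) * pd d i f x)))
    (fun x => |∑ i, (2 * f x * gaussDensity d x.1 *
        (x.1 i * rd d i f x * ρ₀ x.2 + fderiv ℝ ρ₀ x.2 (Pi.single i 1) * pd d i f x))|
        + M * C * (f x ^ 2 * rho0 d ρ₀ x))
    ?_ (hG.abs.add (hf2.const_mul (M * C))) ?_ ?_
  · have h0 := fun n => aux_identity hρ hρper hf hfper (hχ n) _ (hχR n)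
    simp only [h0] at hlim
    exact (tendsto_nhds_unique hlim tendsto_const_nhds)
  · intro n
    apply Continuous.aestronglyMeasurable
    have hχc := (hχ n).continuous
    have hχdc : ∀ i : Fin d, Continuous fun p => fderiv ℝ (χ n) p (Pi.single i 1) := fun i =>
      ((hχ n).continuous_fderiv one_ne_zero).clm_apply continuous_const
    have k1 := fun i : Fin d => (hχdc i).comp
      (continuous_fst : Continuous fun x : (Fin d → ℝ) × (Fin d → ℝ) => x.1)
    have k2 := fun i : Fin d => (hDc i).comp
      (continuous_snd : Continuous fun x : (Fin d → ℝ) × (Fin d → ℝ) => x.2)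
    simp only [Function.comp_def] at k1 k2
    fun_prop
  · intro n
    filter_upwards [hae] with x hx
    rw [Finset.sum_add_distrib, Real.norm_eq_abs]
    refine (abs_add_le _ _).trans (add_le_add ?_ ?_)
    · have : ∑ i, 2 * χ n x.1 * f x * gaussDensity d x.1 *
        (x.1 i * rd d i f x * ρ₀ x.2 + fderiv ℝ ρ₀ x.2 (Pi.single i 1) * pd d i f x)
        = χ n x.1 * ∑ i, 2 * f x * gaussDensity d x.1 *
        (x.1 i * rd d i f x * ρ₀ x.2 + fderiv ℝ ρ₀ x.2 (Pi.single i 1) * pd d i f x) := by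
        rw [Finset.mul_sum]
        exact Finset.sum_congr rfl fun i _ => by ring
      rw [this, abs_mul, abs_of_nonneg φ.nonneg]
      exact mul_le_of_le_one_left (abs_nonneg _) φ.le_one
    · have hgp := aux_gauss_pos d x.1
      have hrp := hρpos x.2
      have hterm : ∀ i, |fderiv ℝ ρ₀ x.2 (Pi.single i 1) * fderiv ℝ (χ n) x.1 (Pi.single i 1)
          * f x ^ 2 * gaussDensity d x.1| ≤ (|fderiv ℝ ρ₀ x.2 (Pi.single i 1)| / ρ₀ x.2) *
            (C * (f x ^ 2 * rho0 d ρ₀ x)) := by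
        intro i
        have hb : |fderiv ℝ (χ n) x.1 (Pi.single i 1)| ≤ C := by
          rw [hχd, abs_mul, abs_of_pos (hc0 n)]
          have h1 := (fderiv ℝ φ (c n • x.1)).le_opNorm (Pi.single i (1:ℝ))
          have h2 : ‖(Pi.single i (1:ℝ) : Fin d → ℝ)‖ = 1 := by
            rw [Pi.norm_single, norm_one]
          rw [h2, mul_one, Real.norm_eq_abs] at h1
          have h3 := h1.trans (hC _)
          exact (mul_le_of_le_one_left (abs_nonneg _) (hc1 n)).trans h3
        rw [abs_mul, abs_mul, abs_mul, abs_of_pos hgp, abs_of_nonneg (sq_nonneg (f x)), rho0]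
        calc _ ≤ |fderiv ℝ ρ₀ x.2 (Pi.single i 1)| * C * f x ^ 2 * gaussDensity d x.1 := by
              gcongr
          _ = _ := by field_simp
      refine (Finset.abs_sum_le_sum_abs _ _).trans ((Finset.sum_le_sum fun i _ => hterm i).trans ?_)
      rw [← Finset.sum_mul, mul_assoc M]
      refine mul_le_mul_of_nonneg_right ((le_abs_self _).trans (hM _ hx)) ?_
      unfold rho0
      positivity
  · refine Eventually.of_forall fun x => ?_
    refine tendsto_finsetSum _ fun i _ => ?_
    have t1 : Tendsto (fun n => χ n x.1) atTop (nhds 1) :=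
      tendsto_const_nhds.congr' ((hχ1 x.1).mono fun n h => h.symm)
    have t2 : Tendsto (fun n => fderiv ℝ (χ n) x.1 (Pi.single i 1)) atTop (nhds 0) := by
      simp only [hχd]
      have hcc : Continuous fun p => fderiv ℝ φ p (Pi.single i 1) :=
        (hφ.continuous_fderiv one_ne_zero).clm_apply continuous_const
      have h1 : Tendsto (fun n => c n • x.1) atTop (nhds 0) := by
        simpa using hct.smul_const x.1
      simpa using hct.mul ((hcc.tendsto 0).comp h1)
    have := ((((t1.const_mul 2).mul_const (f x)).mul_const (gaussDensity d x.1)).mul_const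
      (x.1 i * rd d i f x * ρ₀ x.2 + fderiv ℝ ρ₀ x.2 (Pi.single i 1) * pd d i f x)).add
      (((t2.const_mul (fderiv ℝ ρ₀ x.2 (Pi.single i 1))).mul_const (f x ^ 2)).mul_const
        (gaussDensity d x.1))
    simpa using this

/-- Lemma 6.3 of the paper: the lower bound
⟨f, ℬf⟩ ≥ -K(η‖f‖² + ‖∇_p f‖²/(4η)) for every η > 0. -/
theorem transport_operator_lower_bound (d : ℕ) (ρ₀ : (Fin d → ℝ) → ℝ)
    (b : (Fin d → ℝ) → Fin d → ℝ) (K : ℝ)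
    (hρsm : ContDiff ℝ (⊤ : ℕ∞) ρ₀) (hρpos : ∀ r, 0 < ρ₀ r)
    (hρprob : ∫ r in Set.Icc (0 : Fin d → ℝ) 1, ρ₀ r = 1)
    (hρper : ∀ r : Fin d → ℝ, ∀ i : Fin d, ρ₀ (r + Pi.single i 1) = ρ₀ r)
    (hb : ContDiff ℝ (⊤ : ℕ∞) b)
    (hbper : ∀ r : Fin d → ℝ, ∀ i j : Fin d, b (r + Pi.single i 1) j = b r j)
    (hK : ∀ r, Real.sqrt (∑ i, hfun d b ρ₀ r i ^ 2) ≤ K)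
    (f : (Fin d → ℝ) × (Fin d → ℝ) → ℝ)
    (hf : ContDiff ℝ 1 f) (hfper : PeriodicR d f)
    (hf2 : Integrable (fun x => f x ^ 2 * rho0 d ρ₀ x) (refMeas d))
    (hdpf2 : Integrable (fun x => (∑ i, pd d i f x ^ 2) * rho0 d ρ₀ x) (refMeas d))
    (hdrf2 : Integrable (fun x => (∑ i, rd d i f x ^ 2) * rho0 d ρ₀ x) (refMeas d))
    (hint1 : Integrable (fun x => f x * Bop d b f x * rho0 d ρ₀ x) (refMeas d))
    (hint2 : Integrable (fun x =>
      (∑ i, x.1 i * hfun d b ρ₀ x.2 i) * f x ^ 2 * rho0 d ρ₀ x) (refMeas d))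
    (η : ℝ) (hη : 0 < η) :
    wInt d ρ₀ (fun x => f x * Bop d b f x)
      ≥ -K * (η * wInt d ρ₀ (fun x => f x ^ 2)
          + (1 / (4 * η)) * wInt d ρ₀ (fun x => ∑ i, pd d i f x ^ 2)) := by
  have hρ2 : ContDiff ℝ 2 ρ₀ := contDiff_infty.1 hρsm 2
  have hK0 : 0 ≤ K := (Real.sqrt_nonneg _).trans (hK 0)
  have hpos : ∀ x, 0 < rho0 d ρ₀ x := fun x => mul_pos (aux_gauss_pos d _) (hρpos _)
  have hpt : ∀ x, |f x * ∑ i, hfun d b ρ₀ x.2 i * pd d i f x|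
      ≤ K * (η * f x ^ 2 + (1 / (4 * η)) * ∑ i, pd d i f x ^ 2) := by
    intro x
    have h1 : |∑ i, hfun d b ρ₀ x.2 i * pd d i f x| ≤ K * Real.sqrt (∑ i, pd d i f x ^ 2) := by
      have := Finset.sum_mul_sq_le_sq_mul_sq Finset.univ (fun i => hfun d b ρ₀ x.2 i)
        (fun i => pd d i f x)
      refine (Real.abs_le_sqrt this).trans ?_
      rw [Real.sqrt_mul (Finset.sum_nonneg fun i _ => sq_nonneg _)]
      exact mul_le_mul_of_nonneg_right (hK _) (Real.sqrt_nonneg _)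
    set s := Real.sqrt (∑ i, pd d i f x ^ 2) with hs
    have hs2 : s ^ 2 = ∑ i, pd d i f x ^ 2 :=
      Real.sq_sqrt (Finset.sum_nonneg fun i _ => sq_nonneg _)
    rw [abs_mul, ← hs2]
    have h2 : |f x| * s ≤ η * f x ^ 2 + (1 / (4 * η)) * s ^ 2 := by
      rw [← sq_abs (f x)]
      have : η * |f x| ^ 2 + (1 / (4 * η)) * s ^ 2 - |f x| * s
          = η * (|f x| - s / (2 * η)) ^ 2 := by
        field_simp
        ring
      have h3 : 0 ≤ η * (|f x| - s / (2 * η)) ^ 2 := by positivity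
      linarith
    calc _ ≤ |f x| * (K * s) := mul_le_mul_of_nonneg_left h1 (abs_nonneg _)
      _ = K * (|f x| * s) := by ring
      _ ≤ _ := mul_le_mul_of_nonneg_left h2 hK0
  have hdom : Integrable (fun x => K * (η * (f x ^ 2 * rho0 d ρ₀ x)
      + (1 / (4 * η)) * ((∑ i, pd d i f x ^ 2) * rho0 d ρ₀ x))) (refMeas d) :=
    ((hf2.const_mul η).add (hdpf2.const_mul _)).const_mul K
  have hDc : ∀ i : Fin d, Continuous fun r => fderiv ℝ ρ₀ r (Pi.single i 1) := fun i =>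
    (hρ2.continuous_fderiv two_ne_zero).clm_apply continuous_const
  have hhc : ∀ i : Fin d, Continuous fun r => hfun d b ρ₀ r i := by
    intro i
    unfold hfun
    exact ((continuous_apply i).comp hb.continuous).sub
      ((hDc i).div hρ2.continuous fun r => (hρpos r).ne')
  have hHint : Integrable (fun x => (f x * ∑ i, hfun d b ρ₀ x.2 i * pd d i f x) * rho0 d ρ₀ x)
      (refMeas d) := by
    refine hdom.mono' (Continuous.aestronglyMeasurable ?_) (Eventually.of_forall fun x => ?_)
    · have k1 := fun i => aux_pd_cont i hf
      have k2 := fun i : Fin d => (hhc i).comp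
        (continuous_snd : Continuous fun x : (Fin d → ℝ) × (Fin d → ℝ) => x.2)
      simp only [Function.comp_def] at k2
      have k3 := (aux_gauss_contDiff d).continuous
      have k4 := hf.continuous
      have k5 := hρ2.continuous
      unfold rho0
      fun_prop
    · rw [Real.norm_eq_abs, abs_mul, abs_of_pos (hpos x)]
      refine (mul_le_mul_of_nonneg_right (hpt x) (hpos x).le).trans (le_of_eq ?_)
      ring
  have hGeq : ∀ x, ∑ i, (2 * f x * gaussDensity d x.1 *
        (x.1 i * rd d i f x * ρ₀ x.2 + fderiv ℝ ρ₀ x.2 (Pi.single i 1) * pd d i f x))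
      = 2 * (f x * Bop d b f x * rho0 d ρ₀ x
        - (f x * ∑ i, hfun d b ρ₀ x.2 i * pd d i f x) * rho0 d ρ₀ x) := by
    intro x
    have hne := (hρpos x.2).ne'
    unfold Bop rho0
    rw [← Finset.sum_add_distrib, ← sub_mul, ← mul_sub, ← Finset.sum_sub_distrib, Finset.mul_sum,
      Finset.sum_mul, Finset.mul_sum]
    refine Finset.sum_congr rfl fun i _ => ?_
    unfold hfun
    field_simp
    ring
  have hz := aux_zero hρ2 hρpos hρper hf hfper hf2 (by
    simp only [hGeq]
    exact (hint1.sub hHint).const_mul 2)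
  simp only [hGeq] at hz
  rw [integral_const_mul, integral_sub hint1 hHint] at hz
  have heq : wInt d ρ₀ (fun x => f x * Bop d b f x)
      = ∫ x, (f x * ∑ i, hfun d b ρ₀ x.2 i * pd d i f x) * rho0 d ρ₀ x ∂refMeas d := by
    unfold wInt
    linarith
  have hrhs : ∫ x, K * (η * (f x ^ 2 * rho0 d ρ₀ x)
      + (1 / (4 * η)) * ((∑ i, pd d i f x ^ 2) * rho0 d ρ₀ x)) ∂refMeas d
      = K * (η * wInt d ρ₀ (fun x => f x ^ 2)
          + (1 / (4 * η)) * wInt d ρ₀ (fun x => ∑ i, pd d i f x ^ 2)) := by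
    rw [integral_const_mul, integral_add (hf2.const_mul η) (hdpf2.const_mul _),
      integral_const_mul, integral_const_mul]
    rfl
  rw [heq, ge_iff_le, neg_mul, ← hrhs, ← integral_neg]
  refine integral_mono hdom.neg hHint fun x => ?_
  have h1 := mul_le_mul_of_nonneg_right (neg_le_of_abs_le (hpt x)) (hpos x).le
  refine le_trans (le_of_eq ?_) h1
  ring
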